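/- arXiv:1611.02938 — 5 statements merged into one kernel-verified Lean document; each statement's English description precedes it below -/
import Mathlib

section
/- Let T : ℕ → ℤ be a function with finite support, and define W : ℕ → ℤ by W(k) = ∑_{s≥0} C(2s+2k, s)·T(s+k) (a finite sum, where C(n, m) denotes the binomial coefficient). Then W(0) + 2·∑_{s≥1} (−1)^s·W(s) = T(0). -/
open Finset in
theorem choose_half_add_two_mul_alternating_sum (n : ℕ) :
    ((2 * n).choose n : ℤ) + 2 * ∑ k ∈ range n, (-1) ^ (k + 1) * ((2 * n).choose (n - (k + 1)) : ℤ)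
      = if n = 0 then 1 else 0 := by
  cases n with
  | zero => simp
  | succ m =>
    have key : ∑ k ∈ range (m + 1), (-1) ^ (k + 1) * ((2 * (m + 1)).choose (m + 1 - (k + 1)) : ℤ)
        = -((2 * m + 1).choose m : ℤ) := by
      have h := Int.alternating_sum_range_choose_eq_choose (n := 2 * m + 1) (m := m)
      rw [← sum_range_reflect]
      have h' : ∀ k ∈ range (m + 1),
          (-1 : ℤ) ^ (m + 1 - 1 - k + 1) *
            ((2 * (m + 1)).choose (m + 1 - (m + 1 - 1 - k + 1)) : ℤ)
          = (-1) ^ (m + 1) * ((-1) ^ k * ((2 * m + 1 + 1).choose k : ℤ)) := by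
        intro k hk
        obtain ⟨j, rfl⟩ := Nat.exists_eq_add_of_le (Nat.lt_succ_iff.mp (mem_range.mp hk))
        have e1 : k + j + 1 - 1 - k + 1 = j + 1 := by omega
        have e2 : k + j + 1 - (j + 1) = k := by omega
        have e3 : (-1 : ℤ) ^ k * (-1) ^ k = 1 := by rw [← mul_pow]; simp
        rw [e1, e2, show 2 * (k + j + 1) = 2 * (k + j) + 1 + 1 by ring, pow_succ, pow_succ, pow_add]
        linear_combination (-(-1 : ℤ) ^ j * -1 * ((2 * (k + j) + 1 + 1).choose k : ℤ)) * e3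
      have e3 : (-1 : ℤ) ^ m * (-1) ^ m = 1 := by rw [← mul_pow]; simp
      rw [sum_congr rfl h', ← mul_sum, h, pow_succ]
      linear_combination (-((2 * m + 1).choose m : ℤ)) * e3
    rw [key, if_neg m.succ_ne_zero, show 2 * (m + 1) = 2 * m + 1 + 1 by ring, Nat.choose_succ_succ,
      Nat.choose_symm_half]
    push_cast
    ring

open Finset in
theorem finsum_choose_mul_shift_eq_sum_range {T : ℕ → ℤ} {N : ℕ} (hN : ∀ n, N ≤ n → T n = 0)
    (k : ℕ) :
    ∑ᶠ s : ℕ, ((2 * s + 2 * k).choose s : ℤ) * T (s + k) =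
      ∑ n ∈ range N, if k ≤ n then ((2 * n).choose (n - k) : ℤ) * T n else 0 := by
  rw [finsum_eq_sum_of_support_subset (s := range (N - k))]
  · rw [← sum_filter]
    refine sum_bij (fun s _ => s + k) ?_ ?_ ?_ ?_
    · intro s hs
      simp only [mem_range, mem_filter] at hs ⊢
      omega
    · intro a _ b _ h
      simpa using h
    · intro n hn
      simp only [mem_range, mem_filter] at hn
      exact ⟨n - k, by simp only [mem_range]; omega, by omega⟩
    · intro s _
      simp [mul_add]
  · intro s hs
    by_contra h
    simp only [coe_range, Set.mem_Iio, not_lt] at h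
    exact hs (by simp [hN (s + k) (by omega)])

/-- Inversion identity: if `T : ℕ → ℤ` has finite support and
`W k = ∑_{s ≥ 0} C(2s+2k, s) · T (s+k)`, then
`W 0 + 2 ∑_{s ≥ 1} (−1)^s W s = T 0`. -/
theorem stmt0 (T : ℕ → ℤ) (hT : (Function.support T).Finite)
    (W : ℕ → ℤ)
    (hW : ∀ k : ℕ, W k = ∑ᶠ s : ℕ, ((2 * s + 2 * k).choose s : ℤ) * T (s + k)) :
    W 0 + 2 * ∑ᶠ s ∈ {s : ℕ | 1 ≤ s}, (-1 : ℤ) ^ s * W s = T 0 := by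
  obtain ⟨M, hM⟩ := hT.bddAbove
  obtain ⟨N, hNM⟩ : ∃ N, N = M + 1 := ⟨_, rfl⟩
  have hN : ∀ n, N ≤ n → T n = 0 := by
    intro n hn
    by_contra h
    have := hM (Function.mem_support.mpr h)
    omega
  have hW' : ∀ k, W k =
      ∑ n ∈ Finset.range N, if k ≤ n then ((2 * n).choose (n - k) : ℤ) * T n else 0 :=
    fun k => (hW k).trans (finsum_choose_mul_shift_eq_sum_range hN k)
  have hW0 : ∀ k, N ≤ k → W k = 0 := by
    intro k hk
    rw [hW']
    refine Finset.sum_eq_zero fun n hn => if_neg ?_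
    have := Finset.mem_range.mp hn
    omega
  have hsum : ∑ᶠ s ∈ {s : ℕ | 1 ≤ s}, (-1 : ℤ) ^ s * W s =
      ∑ k ∈ Finset.range N, (-1 : ℤ) ^ (k + 1) * W (k + 1) := by
    rw [finsum_mem_eq_sum_of_inter_support_eq (t := Finset.Ico 1 (N + 1)),
      Finset.sum_Ico_eq_sum_range]
    · simp [add_comm]
    · ext s
      simp only [Set.mem_inter_iff, Set.mem_ofPred_eq, Function.mem_support, Finset.coe_Ico,
        Set.mem_Ico]
      refine ⟨fun ⟨h1, h2⟩ => ⟨⟨h1, ?_⟩, h2⟩, fun ⟨h1, h2⟩ => ⟨h1.1, h2⟩⟩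
      by_contra h
      exact h2 (by simp [hW0 s (by omega)])
  have hcoeff : ∀ n ∈ Finset.range N,
      ∑ k ∈ Finset.range N,
        (-1 : ℤ) ^ (k + 1) * (if k + 1 ≤ n then ((2 * n).choose (n - (k + 1)) : ℤ) * T n else 0) =
      (∑ k ∈ Finset.range n, (-1) ^ (k + 1) * ((2 * n).choose (n - (k + 1)) : ℤ)) * T n := by
    intro n hn
    have hn := Finset.mem_range.mp hn
    rw [Finset.sum_mul]
    symm
    refine Finset.sum_subset_zero_on_sdiff (Finset.range_subset_range.mpr hn.le) ?_ ?_
    · intro k hk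
      simp only [Finset.mem_sdiff, Finset.mem_range] at hk
      rw [if_neg (by omega), mul_zero]
    · intro k hk
      have := Finset.mem_range.mp hk
      rw [if_pos (by omega), mul_assoc]
  rw [hsum, hW' 0]
  simp only [hW', Finset.mul_sum (Finset.range N) _ ((-1 : ℤ) ^ _)]
  rw [Finset.sum_comm, Finset.sum_congr rfl hcoeff, Finset.mul_sum, ← Finset.sum_add_distrib]
  calc _ = ∑ n ∈ Finset.range N, (if n = 0 then 1 else 0) * T n := by
        refine Finset.sum_congr rfl fun n _ => ?_
        rw [← choose_half_add_two_mul_alternating_sum n, if_pos n.zero_le, Nat.sub_zero]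
        ring
    _ = T 0 := by simp [hNM]
end

section
/- Let Λ be the free ℤ-module with basis L, E1, …, E8, equipped with the symmetric bilinear form ⟨·,·⟩ determined by ⟨L,L⟩ = 1, ⟨Ei,Ei⟩ = −1 for 1 ≤ i ≤ 8, and ⟨L,Ei⟩ = 0, ⟨Ei,Ej⟩ = 0 for i ≠ j. Set K = −3L + E1 + ⋯ + E8 and E = 2L − E1 − ⋯ − E6. Then the set of vectors v ∈ Λ with ⟨v,v⟩ = −1, ⟨v,K⟩ = −1 and ⟨v,E⟩ ≥ 1 consists of exactly the following 57 elements: (i) Ei for 1 ≤ i ≤ 6; (ii) L − Ei − E7 and L − Ei − E8 for 1 ≤ i ≤ 6, and L − E7 − E8; (iii) 2L − Ei − Ej − Ek − E7 − E8 for 1 ≤ i < j < k ≤ 6; (iv) 3L − 2Ek − ∑_{1≤i≤8, i∉{j,k}} Ei for 1 ≤ j ≤ 6 and k ∈ {7,8}; (v) 4L − 2Ej − 2E7 − 2E8 − ∑_{1≤i≤6, i≠j} Ei for 1 ≤ j ≤ 6. Moreover, every element of this set satisfies ⟨v,E⟩ = 1 except L − E7 − E8, for which ⟨v,E⟩ =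 2. -/
/-- The intersection form on the Picard lattice `ℤL ⊕ ℤE₁ ⊕ ⋯ ⊕ ℤE₈` of the plane
blown up at 8 points, in coordinates `(Fin 9 → ℤ)` where index `0` is the coefficient
of `L` and index `i` (for `1 ≤ i ≤ 8`) is the coefficient of `Eᵢ`:
`⟨L,L⟩ = 1`, `⟨Eᵢ,Eᵢ⟩ = −1`, different basis vectors are orthogonal. -/
def latticeForm (u v : Fin 9 → ℤ) : ℤ := 2 * u 0 * v 0 - ∑ i, u i * v i

/-- The basis vectors: `bv 0 = L`, `bv i = Eᵢ` for `1 ≤ i ≤ 8`. -/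
def bv (i : Fin 9) : Fin 9 → ℤ := Pi.single i 1

/-- The canonical class `K = −3L + E₁ + ⋯ + E₈`. -/
def Kvec : Fin 9 → ℤ := fun i => if i = 0 then -3 else 1

/-- The `(−2)`-class `E = 2L − E₁ − ⋯ − E₆`. -/
def Evec : Fin 9 → ℤ := fun i => if i = 0 then 2 else if (i : ℕ) ≤ 6 then -1 else 0

/-- The explicit list of 57 classes from the paper (list (2.9)). -/
def exceptionalList : Set (Fin 9 → ℤ) :=
  {v | (∃ i ∈ ({1, 2, 3, 4, 5, 6} : Finset (Fin 9)), v = bv i)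
    ∨ (∃ i ∈ ({1, 2, 3, 4, 5, 6} : Finset (Fin 9)), ∃ j ∈ ({7, 8} : Finset (Fin 9)),
        v = bv 0 - bv i - bv j)
    ∨ v = bv 0 - bv 7 - bv 8
    ∨ (∃ i ∈ ({1, 2, 3, 4, 5, 6} : Finset (Fin 9)), ∃ j ∈ ({1, 2, 3, 4, 5, 6} : Finset (Fin 9)),
        ∃ k ∈ ({1, 2, 3, 4, 5, 6} : Finset (Fin 9)), i < j ∧ j < k ∧
        v = (2 : ℤ) • bv 0 - bv i - bv j - bv k - bv 7 - bv 8)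
    ∨ (∃ j ∈ ({1, 2, 3, 4, 5, 6} : Finset (Fin 9)), ∃ k ∈ ({7, 8} : Finset (Fin 9)),
        v = (3 : ℤ) • bv 0 - (2 : ℤ) • bv k -
          ∑ i ∈ ({1, 2, 3, 4, 5, 6, 7, 8} : Finset (Fin 9)) \ {j, k}, bv i)
    ∨ (∃ j ∈ ({1, 2, 3, 4, 5, 6} : Finset (Fin 9)),
        v = (4 : ℤ) • bv 0 - (2 : ℤ) • bv j - (2 : ℤ) • bv 7 - (2 : ℤ) • bv 8 -
          ∑ i ∈ ({1, 2, 3, 4, 5, 6} : Finset (Fin 9)) \ {j}, bv i)}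

/-- The classes of `exceptionalList` as a list. -/
def exceptionalClasses : List (Fin 9 → ℤ) :=
  let I : List (Fin 9) := [1, 2, 3, 4, 5, 6]
  let J : List (Fin 9) := [7, 8]
  I.map bv
    ++ (I ×ˢ J).map (fun p => bv 0 - bv p.1 - bv p.2)
    ++ [bv 0 - bv 7 - bv 8]
    ++ ((I ×ˢ I ×ˢ I).filter (fun p => p.1 < p.2.1 ∧ p.2.1 < p.2.2)).map
        (fun p => (2 : ℤ) • bv 0 - bv p.1 - bv p.2.1 - bv p.2.2 - bv 7 - bv 8)
    ++ (I ×ˢ J).map (fun p => (3 : ℤ) • bv 0 - (2 : ℤ) • bv p.2 -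
        ∑ i ∈ ({1, 2, 3, 4, 5, 6, 7, 8} : Finset (Fin 9)) \ {p.1, p.2}, bv i)
    ++ I.map (fun j => (4 : ℤ) • bv 0 - (2 : ℤ) • bv j - (2 : ℤ) • bv 7 - (2 : ℤ) • bv 8 -
        ∑ i ∈ ({1, 2, 3, 4, 5, 6} : Finset (Fin 9)) \ {j}, bv i)

/-- The coordinate vectors of `exceptionalClasses`, in a form that evaluates quickly. -/
def exceptionalCoords : List (Fin 9 → ℤ) :=
  let I : List (Fin 9) := [1, 2, 3, 4, 5, 6]
  let J : List (Fin 9) := [7, 8]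
  I.map (fun i x => if x = i then 1 else 0)
    ++ (I ×ˢ J).map (fun p x => if x = 0 then 1 else if x = p.1 ∨ x = p.2 then -1 else 0)
    ++ [![1, 0, 0, 0, 0, 0, 0, -1, -1]]
    ++ ((I ×ˢ I ×ˢ I).filter (fun p => p.1 < p.2.1 ∧ p.2.1 < p.2.2)).map
        (fun p x => if x = 0 then 2
          else if x = p.1 ∨ x = p.2.1 ∨ x = p.2.2 ∨ 7 ≤ x then -1 else 0)
    ++ (I ×ˢ J).map (fun p x => if x = 0 then 3 else if x = p.1 then 0
        else if x = p.2 then -2 else -1)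
    ++ I.map (fun j x => if x = 0 then 4 else if x = j ∨ 7 ≤ x then -2 else -1)

theorem exceptionalClasses_eq_exceptionalCoords : exceptionalClasses = exceptionalCoords := by
  decide +kernel

theorem mem_exceptionalList_iff {v : Fin 9 → ℤ} :
    v ∈ exceptionalList ↔ v ∈ exceptionalCoords := by
  rw [← exceptionalClasses_eq_exceptionalCoords]
  simp only [exceptionalList, exceptionalClasses, Set.mem_ofPred_eq, List.mem_append,
    List.mem_map, List.mem_filter, List.mem_product, Prod.exists, List.mem_singleton, or_assoc]
  refine or_congr ?_ (or_congr ?_ (or_congr Iff.rfl (or_congr ?_ (or_congr ?_ ?_))))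
  all_goals constructor
  all_goals grind

/-- The unit cube of lattice points with lowest corner `c`. -/
def cube (c : Fin 9 → ℤ) : Finset (Fin 9 → ℤ) := Fintype.piFinset fun i => {c i, c i + 1}

/-- This holds because an integer `x` satisfies `x * (x - 1) ≥ 0`, with equality only for
`x ∈ {0, 1}`. -/
theorem mem_cube_of_sum_nonpos {v c : Fin 9 → ℤ}
    (h : ∑ i, (v i - c i) * (v i - c i - 1) ≤ 0) : v ∈ cube c := by
  have hnonneg : ∀ i ∈ Finset.univ, 0 ≤ (v i - c i) * (v i - c i - 1) := fun i _ => by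
    rcases le_or_gt (v i - c i) 0 with hi | hi
    · exact mul_nonneg_of_nonpos_of_nonpos hi (by omega)
    · exact mul_nonneg hi.le (by omega)
  have hzero := (Finset.sum_eq_zero_iff_of_nonneg hnonneg).1
    (le_antisymm h (Finset.sum_nonneg hnonneg))
  refine Fintype.mem_piFinset.2 fun i => ?_
  rcases mul_eq_zero.1 (hzero i (Finset.mem_univ i)) with hi | hi
  · simp [sub_eq_zero.1 hi]
  · simp only [Finset.mem_insert, Finset.mem_singleton]
    omega

theorem latticeForm_self (v : Fin 9 → ℤ) : latticeForm v v = v 0 ^ 2 -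
    (v 1 ^ 2 + v 2 ^ 2 + v 3 ^ 2 + v 4 ^ 2 + v 5 ^ 2 + v 6 ^ 2 + v 7 ^ 2 + v 8 ^ 2) := by
  simp only [latticeForm, Fin.sum_univ_succ, Fin.sum_univ_zero]
  simp only [Fin.reduceSucc]
  ring

theorem latticeForm_Kvec (v : Fin 9 → ℤ) : latticeForm v Kvec =
    -3 * v 0 - (v 1 + v 2 + v 3 + v 4 + v 5 + v 6 + v 7 + v 8) := by
  simp only [latticeForm, Kvec, Fin.sum_univ_succ, Fin.sum_univ_zero]
  simp [Fin.reduceSucc]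
  ring

theorem latticeForm_Evec (v : Fin 9 → ℤ) : latticeForm v Evec =
    2 * v 0 + (v 1 + v 2 + v 3 + v 4 + v 5 + v 6) := by
  simp only [latticeForm, Evec, Fin.sum_univ_succ, Fin.sum_univ_zero]
  simp [Fin.reduceSucc]
  ring

/-- The Cauchy–Schwarz inequality on the first six and on the last two coordinates. -/
theorem degree_inequality {v : Fin 9 → ℤ} (hv : latticeForm v v = -1)
    (hK : latticeForm v Kvec = -1) :
    (v 0 + latticeForm v Evec - 3) ^ 2 + 3 * latticeForm v Evec ^ 2 ≤ 12 := by
  obtain ⟨m, hm⟩ : ∃ m, latticeForm v Evec = m := ⟨_, rfl⟩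
  rw [hm]
  rw [latticeForm_self] at hv
  rw [latticeForm_Kvec] at hK
  rw [latticeForm_Evec] at hm
  have h6 : (v 1 + v 2 + v 3 + v 4 + v 5 + v 6) ^ 2 ≤
      6 * (v 1 ^ 2 + v 2 ^ 2 + v 3 ^ 2 + v 4 ^ 2 + v 5 ^ 2 + v 6 ^ 2) := by
    have := sq_sum_le_card_mul_sum_sq (s := (Finset.univ : Finset (Fin 6)))
      (f := ![v 1, v 2, v 3, v 4, v 5, v 6])
    simpa [Fin.sum_univ_six] using this
  have h2 : (v 7 + v 8) ^ 2 ≤ 2 * (v 7 ^ 2 + v 8 ^ 2) := by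
    nlinarith [sq_nonneg (v 7 - v 8)]
  rw [show v 1 + v 2 + v 3 + v 4 + v 5 + v 6 = m - 2 * v 0 by linarith] at h6
  rw [show v 7 + v 8 = 1 - v 0 - m by linarith] at h2
  nlinarith

/-- Every solution lies in one of four unit cubes. -/
theorem exists_mem_cube {v : Fin 9 → ℤ} (hv : latticeForm v v = -1)
    (hK : latticeForm v Kvec = -1) (hE : 1 ≤ latticeForm v Evec) :
    v ∈ cube ![-1, 0, 0, 0, 0, 0, 0, 0, 0] ∨ v ∈ cube ![1, -1, -1, -1, -1, -1, -1, -1, -1] ∨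
      v ∈ cube ![3, -1, -1, -1, -1, -1, -1, -2, -2] ∨
      v ∈ cube ![4, -2, -2, -2, -2, -2, -2, -2, -2] := by
  have hd := degree_inequality hv hK
  have hm2 : latticeForm v Evec ≤ 2 := by nlinarith [sq_nonneg (v 0 + latticeForm v Evec - 3)]
  have hcases : (-1 ≤ v 0 ∧ v 0 ≤ 5 ∧ latticeForm v Evec = 1) ∨ v 0 = 1 := by
    obtain h | h : latticeForm v Evec = 1 ∨ latticeForm v Evec = 2 := by omega
    · rw [h] at hd
      exact Or.inl ⟨by nlinarith, by nlinarith, h⟩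
    · rw [h] at hd
      exact Or.inr (by nlinarith)
  rw [latticeForm_self] at hv
  rw [latticeForm_Kvec] at hK
  rw [latticeForm_Evec] at hcases
  have hrange : v 0 = -1 ∨ v 0 = 0 ∨ v 0 = 1 ∨ v 0 = 2 ∨
      (v 0 = 3 ∧ v 1 + v 2 + v 3 + v 4 + v 5 + v 6 = -5) ∨ v 0 = 4 ∨ v 0 = 5 := by omega
  rcases hrange with h | h | h | h | ⟨h, h'⟩ | h | h
  on_goal 1 => refine Or.inl (mem_cube_of_sum_nonpos ?_)
  on_goal 2 => refine Or.inl (mem_cube_of_sum_nonpos ?_)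
  on_goal 3 => refine Or.inr (Or.inl (mem_cube_of_sum_nonpos ?_))
  on_goal 4 => refine Or.inr (Or.inl (mem_cube_of_sum_nonpos ?_))
  on_goal 5 => refine Or.inr (Or.inr (Or.inl (mem_cube_of_sum_nonpos ?_)))
  on_goal 6 => refine Or.inr (Or.inr (Or.inr (mem_cube_of_sum_nonpos ?_)))
  on_goal 7 => refine Or.inr (Or.inr (Or.inr (mem_cube_of_sum_nonpos ?_)))
  all_goals
    simp [Fin.sum_univ_succ, h] at hv hK ⊢
    nlinarith

theorem mem_exceptionalCoords_of_mem_cube :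
    ∀ c ∈ ([![-1, 0, 0, 0, 0, 0, 0, 0, 0], ![1, -1, -1, -1, -1, -1, -1, -1, -1],
      ![3, -1, -1, -1, -1, -1, -1, -2, -2],
      ![4, -2, -2, -2, -2, -2, -2, -2, -2]] : List (Fin 9 → ℤ)),
    ∀ v ∈ cube c, -3 * v 0 - (v 1 + v 2 + v 3 + v 4 + v 5 + v 6 + v 7 + v 8) = -1 →
      1 ≤ 2 * v 0 + (v 1 + v 2 + v 3 + v 4 + v 5 + v 6) →
      v 0 ^ 2 - (v 1 ^ 2 + v 2 ^ 2 + v 3 ^ 2 + v 4 ^ 2 + v 5 ^ 2 + v 6 ^ 2 + v 7 ^ 2 + v 8 ^ 2)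
        = -1 → v ∈ exceptionalCoords := by
  decide +kernel

theorem latticeForm_of_mem_exceptionalCoords :
    ∀ v ∈ exceptionalCoords, latticeForm v v = -1 ∧ latticeForm v Kvec = -1 ∧
      (v = bv 0 - bv 7 - bv 8 → latticeForm v Evec = 2) ∧
      (v ≠ bv 0 - bv 7 - bv 8 → latticeForm v Evec = 1) := by
  decide +kernel

theorem nodup_exceptionalCoords : exceptionalCoords.Nodup := by
  decide +kernel

theorem length_exceptionalCoords : exceptionalCoords.length = 57 := by
  decide +kernel

theorem ncard_exceptionalList : exceptionalList.ncard = 57 := by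
  rw [show exceptionalList = ↑exceptionalCoords.toFinset by ext v; simp [mem_exceptionalList_iff],
    Set.ncard_coe_finset, List.toFinset_card_of_nodup nodup_exceptionalCoords,
    length_exceptionalCoords]

/-- The classes `v` with `v² = −1`, `v·K = −1`, `v·E ≥ 1` are exactly the 57 elements
of the explicit list; moreover all of them satisfy `v·E = 1` except `L − E₇ − E₈`,
for which `v·E = 2`. -/
theorem stmt2 :
    {v : Fin 9 → ℤ | latticeForm v v = -1 ∧ latticeForm v Kvec = -1 ∧ 1 ≤ latticeForm v Evec}
        = exceptionalList ∧
    exceptionalList.ncard = 57 ∧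
    (∀ v ∈ exceptionalList,
      (v = bv 0 - bv 7 - bv 8 → latticeForm v Evec = 2) ∧
      (v ≠ bv 0 - bv 7 - bv 8 → latticeForm v Evec = 1)) := by
  refine ⟨Set.ext fun v => ⟨fun ⟨hv, hK, hE⟩ => ?_, fun h => ?_⟩, ncard_exceptionalList,
    fun v h => (latticeForm_of_mem_exceptionalCoords v (mem_exceptionalList_iff.1 h)).2.2⟩
  · rw [mem_exceptionalList_iff]
    have hcube := exists_mem_cube hv hK hE
    rw [latticeForm_self] at hv
    rw [latticeForm_Kvec] at hK
    rw [latticeForm_Evec] at hE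
    rcases hcube with h | h | h | h <;>
      exact mem_exceptionalCoords_of_mem_cube _ (by simp) v h hK hE hv
  · obtain ⟨hv, hK, h2, h1⟩ :=
      latticeForm_of_mem_exceptionalCoords v (mem_exceptionalList_iff.1 h)
    refine ⟨hv, hK, ?_⟩
    by_cases h0 : v = bv 0 - bv 7 - bv 8
    · exact (h2 h0).symm ▸ one_le_two
    · exact (h1 h0).ge
end

section
/- Let d, d1, …, d8 be nonnegative integers satisfying 2d − (d1 + ⋯ + d6) = 2, 3d − (d1 + ⋯ + d8) = 2, and d² = d1² + ⋯ + d8². Then d ≤ 7. -/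
/-- If nonnegative integers `d, d1, …, d8` satisfy `2d − (d1+⋯+d6) = 2`,
`3d − (d1+⋯+d8) = 2` and `d² = d1² + ⋯ + d8²`, then `d ≤ 7`. -/
theorem stmt4 (d d1 d2 d3 d4 d5 d6 d7 d8 : ℤ)
    (hd : 0 ≤ d) (h1 : 0 ≤ d1) (h2 : 0 ≤ d2) (h3 : 0 ≤ d3) (h4 : 0 ≤ d4)
    (h5 : 0 ≤ d5) (h6 : 0 ≤ d6) (h7 : 0 ≤ d7) (h8 : 0 ≤ d8)
    (e1 : 2 * d - (d1 + d2 + d3 + d4 + d5 + d6) = 2)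
    (e2 : 3 * d - (d1 + d2 + d3 + d4 + d5 + d6 + d7 + d8) = 2)
    (e3 : d ^ 2 = d1 ^ 2 + d2 ^ 2 + d3 ^ 2 + d4 ^ 2 + d5 ^ 2 + d6 ^ 2 + d7 ^ 2 + d8 ^ 2) :
    d ≤ 7 := by
  have hsum : d1 + d2 + d3 + d4 + d5 + d6 = 2 * (d - 1) := by linarith
  have hpair : d8 = d - d7 := by linarith
  have hsix : (2 * (d - 1)) ^ 2 ≤
      6 * (d1 ^ 2 + d2 ^ 2 + d3 ^ 2 + d4 ^ 2 + d5 ^ 2 + d6 ^ 2) := by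
    have h := sq_sum_le_card_mul_sum_sq (s := Finset.univ) (f := ![d1, d2, d3, d4, d5, d6])
    simpa [Fin.sum_univ_six, hsum] using h
  have htwo : d ^ 2 ≤ 2 * (d7 ^ 2 + d8 ^ 2) := by
    subst hpair
    nlinarith [sq_nonneg (2 * d7 - d)]
  nlinarith
end

section
/- Let d ≥ 1 and d1 ≥ d2 ≥ ⋯ ≥ d6 ≥ 0, d7 ≥ d8 ≥ 0 be integers satisfying 2d − (d1 + ⋯ + d6) = 2 and 3d − (d1 + ⋯ + d8) = 2. If d1 + d2 + d7 ≤ d, then (d; d1, …, d8) equals either (1; 0,0,0,0,0,0,1,0) or (4; 1,1,1,1,1,1,2,2). -/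
/-- Minimal expressions under Cremona reduction: if `d ≥ 1`,
`d1 ≥ d2 ≥ ⋯ ≥ d6 ≥ 0`, `d7 ≥ d8 ≥ 0` satisfy `2d − (d1+⋯+d6) = 2`,
`3d − (d1+⋯+d8) = 2` and `d1 + d2 + d7 ≤ d`, then the tuple is
`(1; 0,0,0,0,0,0,1,0)` or `(4; 1,1,1,1,1,1,2,2)`. -/
theorem stmt5 (d d1 d2 d3 d4 d5 d6 d7 d8 : ℤ)
    (hd : 1 ≤ d)
    (h12 : d1 ≥ d2) (h23 : d2 ≥ d3) (h34 : d3 ≥ d4) (h45 : d4 ≥ d5) (h56 : d5 ≥ d6)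
    (h6 : d6 ≥ 0) (h78 : d7 ≥ d8) (h8 : d8 ≥ 0)
    (e1 : 2 * d - (d1 + d2 + d3 + d4 + d5 + d6) = 2)
    (e2 : 3 * d - (d1 + d2 + d3 + d4 + d5 + d6 + d7 + d8) = 2)
    (hmin : d1 + d2 + d7 ≤ d) :
    (d = 1 ∧ d1 = 0 ∧ d2 = 0 ∧ d3 = 0 ∧ d4 = 0 ∧ d5 = 0 ∧ d6 = 0 ∧ d7 = 1 ∧ d8 = 0) ∨
    (d = 4 ∧ d1 = 1 ∧ d2 = 1 ∧ d3 = 1 ∧ d4 = 1 ∧ d5 = 1 ∧ d6 = 1 ∧ d7 = 2 ∧ d8 = 2) := by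
  have hd4 : d ≤ 4 := by linarith
  interval_cases d <;> omega
end

section
/- Call a tuple of nonnegative integers (d; d1, …, d8) a solution if 2d − (d1 + ⋯ + d6) = 2, 3d − (d1 + ⋯ + d8) = 2, and d² = d1² + ⋯ + d8². Define the Cremona move at indices (i, j) with 1 ≤ i < j ≤ 6 as the transformation replacing (d; d1, …, d8) by the tuple with d ↦ 2d − di − dj − d7, di ↦ d − dj − d7, dj ↦ d − di − d7, d7 ↦ d − di − dj, and all other entries unchanged. Then every solution with d ≥ 1 can be transformed into the tuple (1; 0,0,0,0,0,0,1,0) by a finite sequence of moves, each of which is a permutation of (d1, …, d6), the transposition of d7 and d8, or a Cremona move, and such that every intermediate tuple is again a solution consisting of nonnegative integers. -/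
/-- A tuple `(d; d1, …, d8)` of nonnegative integers (encoded as `(d, a)` with
`a i = d(i+1)`) is a *solution* if `2d − (d1+⋯+d6) = 2`, `3d − (d1+⋯+d8) = 2`
and `d² = d1² + ⋯ + d8²`. -/
def IsSol (t : ℤ × (Fin 8 → ℤ)) : Prop :=
  0 ≤ t.1 ∧ (∀ i, 0 ≤ t.2 i) ∧
  2 * t.1 - (∑ i ∈ ({0, 1, 2, 3, 4, 5} : Finset (Fin 8)), t.2 i) = 2 ∧
  3 * t.1 - (∑ i, t.2 i) = 2 ∧
  t.1 ^ 2 = ∑ i, t.2 i ^ 2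

/-- The admissible moves: a permutation of `(d1, …, d6)`, the transposition of
`d7` and `d8` (indices `6` and `7`), or a Cremona move at indices `(i, j)` with
`1 ≤ i < j ≤ 6` (indices `i, j < 6` in the encoding), which sends
`d ↦ 2d − dᵢ − dⱼ − d₇`, `dᵢ ↦ d − dⱼ − d₇`, `dⱼ ↦ d − dᵢ − d₇`,
`d₇ ↦ d − dᵢ − dⱼ`, all other entries unchanged. -/
def IsMove (t t' : ℤ × (Fin 8 → ℤ)) : Prop :=
  (∃ σ : Equiv.Perm (Fin 8), (∀ i : Fin 8, 6 ≤ (i : ℕ) → σ i = i) ∧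
      t'.1 = t.1 ∧ t'.2 = t.2 ∘ σ)
  ∨ (t'.1 = t.1 ∧ t'.2 = t.2 ∘ (Equiv.swap (6 : Fin 8) 7))
  ∨ (∃ i j : Fin 8, (i : ℕ) < 6 ∧ (j : ℕ) < 6 ∧ i < j ∧
      t'.1 = 2 * t.1 - t.2 i - t.2 j - t.2 6 ∧
      t'.2 = Function.update (Function.update (Function.update t.2
        i (t.1 - t.2 j - t.2 6)) j (t.1 - t.2 i - t.2 6)) 6 (t.1 - t.2 i - t.2 j))

open Finset in
theorem sum_comp_update {ι α M : Type*} [DecidableEq ι] [AddCommGroup M] (s : Finset ι)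
    (g : α → M) (a : ι → α) {i : ι} (hi : i ∈ s) (v : α) :
    ∑ x ∈ s, g (Function.update a i v x) = ∑ x ∈ s, g (a x) + g v - g (a i) := by
  rw [← add_sum_erase s _ hi, ← add_sum_erase s (fun x => g (a x)) hi,
    sum_congr rfl fun x hx => by rw [Function.update_of_ne (ne_of_mem_erase hx)]]
  simp only [Function.update_self]
  abel

/-- The indices of `d1, …, d6`. -/
abbrev conicIndices : Finset (Fin 8) := {0, 1, 2, 3, 4, 5}

theorem mem_conicIndices {i : Fin 8} : i ∈ conicIndices ↔ (i : ℕ) < 6 := by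
  revert i; decide

theorem sum_eq_sum_conicIndices (f : Fin 8 → ℤ) :
    ∑ i, f i = ∑ i ∈ conicIndices, f i + f 6 + f 7 := by
  have : (Finset.univ : Finset (Fin 8)) = insert 6 (insert 7 conicIndices) := by decide
  rw [this, Finset.sum_insert (by decide), Finset.sum_insert (by decide)]
  ring

theorem isSol_iff (t : ℤ × (Fin 8 → ℤ)) :
    IsSol t ↔ (∀ i, 0 ≤ t.2 i) ∧ t.1 = t.2 6 + t.2 7 ∧
      ∑ i ∈ conicIndices, t.2 i = 2 * (t.2 6 + t.2 7) - 2 ∧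
      ∑ i ∈ conicIndices, t.2 i ^ 2 = 2 * t.2 6 * t.2 7 := by
  unfold IsSol
  rw [sum_eq_sum_conicIndices, sum_eq_sum_conicIndices]
  constructor
  · rintro ⟨-, h0, h1, h2, h3⟩
    have h : t.1 = t.2 6 + t.2 7 := by linarith
    refine ⟨h0, h, by linarith, ?_⟩
    rw [h] at h3
    linarith
  · rintro ⟨h0, h, h1, h2⟩
    refine ⟨by linarith [h0 6, h0 7], h0, by linarith, by linarith, ?_⟩
    rw [h, h2]
    ring

theorem IsSol.swap {t : ℤ × (Fin 8 → ℤ)} (ht : IsSol t) :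
    IsSol (t.1, t.2 ∘ Equiv.swap (6 : Fin 8) 7) := by
  obtain ⟨h0, h, h1, h2⟩ := (isSol_iff t).1 ht
  have hs : ∀ i ∈ conicIndices, Equiv.swap (6 : Fin 8) 7 i = i := by decide
  rw [isSol_iff]
  dsimp only
  refine ⟨fun i => h0 _, ?_, ?_, ?_⟩
  · simp [h, add_comm]
  · rw [Finset.sum_congr rfl fun i hi => by rw [Function.comp_apply, hs i hi], h1]
    simp [add_comm]
  · rw [Finset.sum_congr rfl fun i hi => by rw [Function.comp_apply, hs i hi], h2]
    simp only [Function.comp_apply, Equiv.swap_apply_left, Equiv.swap_apply_right]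
    ring

/-- The Cremona move at indices `(i, j)`. -/
def cremona (t : ℤ × (Fin 8 → ℤ)) (i j : Fin 8) : ℤ × (Fin 8 → ℤ) :=
  (2 * t.1 - t.2 i - t.2 j - t.2 6,
    Function.update (Function.update (Function.update t.2
      i (t.1 - t.2 j - t.2 6)) j (t.1 - t.2 i - t.2 6)) 6 (t.1 - t.2 i - t.2 j))

theorem sum_conicIndices_cremona (g : ℤ → ℤ) (t : ℤ × (Fin 8 → ℤ)) {i j : Fin 8}
    (hi : i ∈ conicIndices) (hj : j ∈ conicIndices) (hij : i ≠ j) :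
    ∑ k ∈ conicIndices, g ((cremona t i j).2 k) = ∑ k ∈ conicIndices, g (t.2 k)
      + g (t.1 - t.2 j - t.2 6) - g (t.2 i) + g (t.1 - t.2 i - t.2 6) - g (t.2 j) := by
  have h6 : ∀ k ∈ conicIndices, k ≠ 6 := by decide
  dsimp only [cremona]
  rw [Finset.sum_congr rfl fun k hk => by rw [Function.update_of_ne (h6 k hk)],
    sum_comp_update _ _ _ hj, sum_comp_update _ _ _ hi, Function.update_of_ne hij.symm]

theorem IsSol.isSol_cremona {t : ℤ × (Fin 8 → ℤ)} (ht : IsSol t) {i j : Fin 8}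
    (hi : i ∈ conicIndices) (hj : j ∈ conicIndices) (hij : i ≠ j)
    (hi7 : t.2 i ≤ t.2 7) (hj7 : t.2 j ≤ t.2 7) (h76 : t.2 7 ≤ t.2 6) :
    IsSol (cremona t i j) := by
  obtain ⟨h0, h, h1, h2⟩ := (isSol_iff t).1 ht
  have h7 : ∀ k ∈ conicIndices, (7 : Fin 8) ≠ k := by decide
  have e6 : (cremona t i j).2 6 = t.1 - t.2 i - t.2 j := by simp [cremona]
  have e7 : (cremona t i j).2 7 = t.2 7 := by
    simp [cremona, Function.update_of_ne (h7 i hi), Function.update_of_ne (h7 j hj)]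
  rw [isSol_iff, e6, e7, sum_conicIndices_cremona (fun x => x) t hi hj hij,
    sum_conicIndices_cremona (fun x => x ^ 2) t hi hj hij, h1, h2]
  refine ⟨fun k => ?_, ?_, ?_, ?_⟩
  · simp only [cremona, Function.update_apply]
    split_ifs
    · linarith
    · linarith
    · linarith
    · exact h0 k
  · simp only [cremona]
    linarith
  · linarith
  · rw [h]
    ring

theorem IsSol.le_seven {t : ℤ × (Fin 8 → ℤ)} (ht : IsSol t) {i : Fin 8}
    (hi : i ∈ conicIndices) : t.2 i ≤ t.2 7 := by
  obtain ⟨h0, -, h1, h2⟩ := (isSol_iff t).1 ht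
  have hc : (conicIndices.erase i).card = 5 := by
    rw [Finset.card_erase_of_mem hi]; rfl
  have hcs := sq_sum_le_card_mul_sum_sq (s := conicIndices.erase i) (f := t.2)
  rw [hc] at hcs
  rw [← Finset.add_sum_erase _ _ hi] at h1 h2
  rw [eq_sub_of_add_eq' h1, eq_sub_of_add_eq' h2] at hcs
  by_contra! hlt
  push_cast at hcs
  obtain ⟨s, hs⟩ : ∃ s, t.2 i = t.2 7 + 1 + s := ⟨t.2 i - t.2 7 - 1, by ring⟩
  have hs0 : 0 ≤ s := by linarith
  rw [hs] at hcs
  nlinarith [h0 6, h0 7, sq_nonneg (4 * t.2 6 - 3 * t.2 7 - 6), sq_nonneg (t.2 7),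
    sq_nonneg (4 * t.2 6 - 3 * t.2 7 - 6 - 2 * s), mul_nonneg hs0 (h0 7), sq_nonneg (3 * t.2 7 - 2)]

theorem IsSol.exists_lt_add {t : ℤ × (Fin 8 → ℤ)} (ht : IsSol t) (h76 : t.2 7 ≤ t.2 6)
    (h7 : 1 ≤ t.2 7) :
    ∃ i ∈ conicIndices, ∃ j ∈ conicIndices, i < j ∧ t.2 7 < t.2 i + t.2 j := by
  obtain ⟨h0, -, h1, h2⟩ := (isSol_iff t).1 ht
  by_contra! hcon
  have hpair : ∀ i ∈ conicIndices, ∀ j ∈ conicIndices, i ≠ j → t.2 i + t.2 j ≤ t.2 7 := by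
    intro i hi j hj hij
    rcases hij.lt_or_gt with h | h
    · exact hcon i hi j hj h
    · linarith [hcon j hj i hi h]
  obtain ⟨i, hi, hmax⟩ := conicIndices.exists_max_image t.2 ⟨0, by decide⟩
  rcases le_or_gt (2 * t.2 i) (t.2 7) with hle | hlt
  · have hsum : ∑ k ∈ conicIndices, t.2 k ^ 2 ≤ t.2 i * ∑ k ∈ conicIndices, t.2 k := by
      rw [Finset.mul_sum]
      exact Finset.sum_le_sum fun k hk => by nlinarith [hmax k hk, h0 k]
    rw [h1, h2] at hsum
    nlinarith
  · have hsum : ∑ k ∈ conicIndices.erase i, t.2 k ^ 2 ≤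
        (t.2 7 - t.2 i) * ∑ k ∈ conicIndices.erase i, t.2 k := by
      rw [Finset.mul_sum]
      refine Finset.sum_le_sum fun k hk => ?_
      have := hpair i hi k (Finset.mem_of_mem_erase hk) (Finset.ne_of_mem_erase hk).symm
      nlinarith [h0 k]
    have hi7 := ht.le_seven hi
    rw [← Finset.add_sum_erase _ _ hi] at h1 h2
    rw [eq_sub_of_add_eq' h1, eq_sub_of_add_eq' h2] at hsum
    nlinarith [mul_nonneg (sub_nonneg.2 hi7) (sub_nonneg.2 hlt.le),
      mul_nonneg (sub_nonneg.2 h76) (sub_nonneg.2 hlt.le),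
      mul_nonneg (sub_nonneg.2 h76) (h0 7)]

theorem IsSol.eq_of_seven_eq_zero {t : ℤ × (Fin 8 → ℤ)} (ht : IsSol t) (h7 : t.2 7 = 0) :
    t = ((1 : ℤ), fun i : Fin 8 => if i = (6 : Fin 8) then (1 : ℤ) else 0) := by
  obtain ⟨h0, h, h1, -⟩ := (isSol_iff t).1 ht
  have hz : ∀ i ∈ conicIndices, t.2 i = 0 := fun i hi =>
    le_antisymm (h7 ▸ ht.le_seven hi) (h0 i)
  rw [Finset.sum_eq_zero hz] at h1
  have h6 : t.2 6 = 1 := by linarith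
  have hcases : ∀ i : Fin 8, i ∈ conicIndices ∨ i = 6 ∨ i = 7 := by decide
  refine Prod.ext (by simp [h, h6, h7]) (funext fun i => ?_)
  dsimp only
  split_ifs with hi
  · rw [hi, h6]
  · rcases hcases i with hi' | hi' | hi'
    · exact hz i hi'
    · exact absurd hi' hi
    · rw [hi', h7]

/-- One step of a path of solutions. -/
def SolStep (t t' : ℤ × (Fin 8 → ℤ)) : Prop := IsMove t t' ∧ IsSol t'

theorem reflTransGen_solStep (t : ℤ × (Fin 8 → ℤ)) (ht : IsSol t) (hd : 1 ≤ t.1) :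
    Relation.ReflTransGen SolStep t
      ((1 : ℤ), fun i : Fin 8 => if i = (6 : Fin 8) then (1 : ℤ) else 0) := by
  induction hn : t.1.toNat using Nat.strong_induction_on generalizing t with
  | _ n ih =>
    subst hn
    have descend : ∀ u : ℤ × (Fin 8 → ℤ), IsSol u → u.1 = t.1 → u.2 7 ≤ u.2 6 →
        Relation.ReflTransGen SolStep u
          ((1 : ℤ), fun i : Fin 8 => if i = (6 : Fin 8) then (1 : ℤ) else 0) := by
      intro u hu hut h76
      obtain ⟨h0, h, -, -⟩ := (isSol_iff u).1 hu
      rcases (h0 7).eq_or_lt with h7 | h7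
      · rw [← hu.eq_of_seven_eq_zero h7.symm]
      · obtain ⟨i, hi, j, hj, hij, hlt⟩ := hu.exists_lt_add h76 h7
        have hi7 := hu.le_seven hi
        have hj7 := hu.le_seven hj
        have hs := hu.isSol_cremona hi hj hij.ne hi7 hj7 h76
        have hd' : (cremona u i j).1 = 2 * u.1 - u.2 i - u.2 j - u.2 6 := rfl
        exact .head ⟨.inr (.inr ⟨i, j, mem_conicIndices.1 hi, mem_conicIndices.1 hj, hij,
          rfl, rfl⟩), hs⟩ (ih _ (by omega) _ hs (by omega) rfl)
    rcases le_total (t.2 7) (t.2 6) with h76 | h67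
    · exact descend t ht rfl h76
    · have hswap : SolStep t (t.1, t.2 ∘ Equiv.swap (6 : Fin 8) 7) :=
        ⟨.inr (.inl ⟨rfl, rfl⟩), ht.swap⟩
      exact .head hswap (descend _ ht.swap rfl (by simpa using h67))

theorem exists_seq_of_reflTransGen_solStep {t u : ℤ × (Fin 8 → ℤ)} (ht : IsSol t)
    (h : Relation.ReflTransGen SolStep t u) :
    ∃ (n : ℕ) (c : ℕ → ℤ × (Fin 8 → ℤ)), c 0 = t ∧ c n = u ∧
      (∀ k < n, IsMove (c k) (c (k + 1))) ∧ (∀ k ≤ n, IsSol (c k)) := by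
  induction h using Relation.ReflTransGen.head_induction_on with
  | refl => exact ⟨0, fun _ => u, rfl, rfl, by simp, fun _ _ => ht⟩
  | @head t _ hstep _ ih =>
    obtain ⟨n, c, hc0, hcn, hmove, hsol⟩ := ih hstep.2
    refine ⟨n + 1, fun k => k.casesOn t c, rfl, hcn, ?_, ?_⟩
    · rintro (_ | k) hk
      · change IsMove t (c 0)
        exact hc0 ▸ hstep.1
      · exact hmove k (by omega)
    · rintro (_ | k) hk
      · exact ht
      · exact hsol k (by omega)

/-- Cremona reduction: every solution with `d ≥ 1` can be transformed into the
tuple `(1; 0,0,0,0,0,0,1,0)` by finitely many moves, all intermediate tuples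
being again solutions consisting of nonnegative integers. -/
theorem stmt6 (t : ℤ × (Fin 8 → ℤ)) (ht : IsSol t) (hd : 1 ≤ t.1) :
    ∃ (n : ℕ) (c : ℕ → ℤ × (Fin 8 → ℤ)),
      c 0 = t ∧
      c n = ((1 : ℤ), fun i : Fin 8 => if i = (6 : Fin 8) then (1 : ℤ) else 0) ∧
      (∀ k < n, IsMove (c k) (c (k + 1))) ∧
      (∀ k ≤ n, IsSol (c k)) := by
  exact exists_seq_of_reflTransGen_solStep ht (reflTransGen_solStep t ht hd)
end
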